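/- For all integers k ≥ 2 and n ≥ m ≥ 1, the k-move deduction number of the complete bipartite graph K_{m,n} equals m + ⌈n/2⌉ − 1. -/

import Mathlib

namespace Deduction

variable {V : Type*}

/-- The number of times searcher `i` has moved before stage `s`. -/
noncomputable def movesBefore {d : ℕ} (t : ℕ → Fin d → V) (i : Fin d) (s : ℕ) : ℕ :=
  Set.ncard {s' : ℕ | s' < s ∧ t (s' + 1) i ≠ t s' i}

/-- The set of vertices protected by stage `s`: those occupied by some searcher
at some stage `s' ≤ s`. -/
def protectedSet {d : ℕ} (t : ℕ → Fin d → V) (s : ℕ) : Set V :=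
  {v | ∃ i : Fin d, ∃ s' ≤ s, t s' i = v}

/-- The unprotected neighbours of `v` at stage `s`. -/
def unprotNbrs (G : SimpleGraph V) {d : ℕ} (t : ℕ → Fin d → V) (s : ℕ) (v : V) : Set V :=
  {u | G.Adj v u ∧ u ∉ protectedSet t s}

/-- The mobile searchers located on `v` at stage `s` (those having moved fewer
than `k` times). -/
def mobileOn (k : ℕ) {d : ℕ} (t : ℕ → Fin d → V) (s : ℕ) (v : V) : Set (Fin d) :=
  {i | t s i = v ∧ movesBefore t i s < k}

/-- A valid play of the `k`-move deduction game with `d` searchers: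
searchers move along edges (or stay); each searcher moves at most `k` times;
the mobile searchers on a vertex `v` move, covering all unprotected neighbours
of `v`, exactly when there is at least one unprotected neighbour and the number
of mobile searchers on `v` is at least the number of unprotected neighbours of
`v`; otherwise the searchers on `v` stay put. -/
def ValidPlay (G : SimpleGraph V) (k : ℕ) {d : ℕ} (t : ℕ → Fin d → V) : Prop :=
  (∀ i s, t (s + 1) i = t s i ∨ G.Adj (t s i) (t (s + 1) i)) ∧
  (∀ i s, movesBefore t i s ≤ k) ∧
  (∀ s v,
    (((unprotNbrs G t s v).Nonempty ∧
        (unprotNbrs G t s v).ncard ≤ (mobileOn k t s v).ncard) →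
      (∀ i ∈ mobileOn k t s v, t (s + 1) i ∈ unprotNbrs G t s v) ∧
      (∀ u ∈ unprotNbrs G t s v, ∃ i ∈ mobileOn k t s v, t (s + 1) i = u)) ∧
    ((¬ ((unprotNbrs G t s v).Nonempty ∧
        (unprotNbrs G t s v).ncard ≤ (mobileOn k t s v).ncard)) →
      ∀ i, t s i = v → t (s + 1) i = t s i))

/-- A successful play: a valid play in which every vertex is eventually
protected (occupied by some searcher at some stage). -/
def Successful (G : SimpleGraph V) (k : ℕ) {d : ℕ} (t : ℕ → Fin d → V) : Prop :=
  ValidPlay G k t ∧ ∀ v : V, ∃ (i : Fin d) (s : ℕ), t s i = v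

/-- The `k`-move deduction number: the least number of searchers admitting a
successful layout (play) of the `k`-move deduction game on `G`. -/
noncomputable def deductionNumber (G : SimpleGraph V) (k : ℕ) : ℕ :=
  sInf {d : ℕ | ∃ t : ℕ → Fin d → V, Successful G k t}

end Deduction

namespace Deduction

theorem movesBefore_zero {d : ℕ} (t : ℕ → Fin d → V) (i : Fin d) : movesBefore t i 0 = 0 := by
  simp [movesBefore]

theorem movesBefore_succ_le {d : ℕ} (t : ℕ → Fin d → V) (i : Fin d) (s : ℕ) :
    movesBefore t i (s + 1) ≤ movesBefore t i s + 1 := by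
  unfold movesBefore
  refine le_trans (Set.ncard_le_ncard (t := insert s {s' : ℕ | s' < s ∧ t (s' + 1) i ≠ t s' i})
    ?_ ?_) (Set.ncard_insert_le _ _)
  · rintro x ⟨h1, h2⟩
    rcases Nat.lt_succ_iff_lt_or_eq.1 h1 with h | h
    · exact Or.inr ⟨h, h2⟩
    · exact Or.inl h
  · exact ((Set.finite_lt_nat s).subset (fun x hx => hx.1)).insert _

theorem movesBefore_succ_of_eq {d : ℕ} (t : ℕ → Fin d → V) (i : Fin d) (s : ℕ)
    (h : t (s + 1) i = t s i) :
    movesBefore t i (s + 1) = movesBefore t i s := by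
  unfold movesBefore
  congr 1
  ext x
  constructor
  · rintro ⟨h1, h2⟩
    rcases Nat.lt_succ_iff_lt_or_eq.1 h1 with h' | h'
    · exact ⟨h', h2⟩
    · subst h'; exact absurd h h2
  · rintro ⟨h1, h2⟩
    exact ⟨Nat.lt_succ_of_lt h1, h2⟩

theorem movesBefore_congr {d : ℕ} {t t' : ℕ → Fin d → V} {s : ℕ} (h : ∀ j ≤ s, t j = t' j)
    (i : Fin d) : movesBefore t i s = movesBefore t' i s := by
  unfold movesBefore
  congr 1
  ext x
  simp only [Set.mem_ofPred_eq]
  refine and_congr_right fun hx => ?_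
  rw [h x hx.le, h (x + 1) hx]

theorem protectedSet_congr {d : ℕ} {t t' : ℕ → Fin d → V} {s : ℕ} (h : ∀ j ≤ s, t j = t' j) :
    protectedSet t s = protectedSet t' s := by
  ext v
  simp only [protectedSet, Set.mem_ofPred_eq]
  constructor
  · rintro ⟨i, s', hs, e⟩; exact ⟨i, s', hs, by rw [← h s' hs]; exact e⟩
  · rintro ⟨i, s', hs, e⟩; exact ⟨i, s', hs, by rw [h s' hs]; exact e⟩

theorem unprotNbrs_congr (G : SimpleGraph V) {d : ℕ} {t t' : ℕ → Fin d → V} {s : ℕ}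
    (h : ∀ j ≤ s, t j = t' j) (v : V) : unprotNbrs G t s v = unprotNbrs G t' s v := by
  unfold unprotNbrs
  rw [protectedSet_congr h]

theorem mobileOn_congr (k : ℕ) {d : ℕ} {t t' : ℕ → Fin d → V} {s : ℕ}
    (h : ∀ j ≤ s, t j = t' j) (v : V) : mobileOn k t s v = mobileOn k t' s v := by
  unfold mobileOn
  ext i
  simp only [Set.mem_ofPred_eq, movesBefore_congr h, h s le_rfl]

/-- The vertex `v` fires at stage `s`. -/
def Fires (G : SimpleGraph V) (k : ℕ) {d : ℕ} (t : ℕ → Fin d → V) (s : ℕ) (v : V) : Prop :=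
  (unprotNbrs G t s v).Nonempty ∧ (unprotNbrs G t s v).ncard ≤ (mobileOn k t s v).ncard

theorem exists_surj {ι : Type*} [Finite ι] [Finite V] (A : Set V) (M : Set ι) (hA : A.Nonempty)
    (h : A.ncard ≤ M.ncard) :
    ∃ f : ι → V, (∀ i ∈ M, f i ∈ A) ∧ ∀ u ∈ A, ∃ i ∈ M, f i = u := by
  classical
  obtain ⟨a, ha⟩ := hA
  have h1 : Nat.card A ≤ Nat.card M := h
  have := Fintype.ofFinite A
  have := Fintype.ofFinite M
  rw [Nat.card_eq_fintype_card, Nat.card_eq_fintype_card] at h1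
  obtain ⟨g⟩ := Function.Embedding.nonempty_of_card_le h1
  haveI : Nonempty A := ⟨⟨a, ha⟩⟩
  refine ⟨fun i => if hi : i ∈ M then (Function.invFun g ⟨i, hi⟩ : A) else a, ?_, ?_⟩
  · intro i hi
    simp only [hi, dif_pos]
    exact Subtype.coe_prop _
  · intro u hu
    refine ⟨(g ⟨u, hu⟩ : M), (g ⟨u, hu⟩).2, ?_⟩
    simp only [Subtype.coe_prop, dif_pos, Subtype.coe_eta]
    rw [Function.leftInverse_invFun g.injective]

theorem exists_next [Finite V] (G : SimpleGraph V) (k : ℕ) {d : ℕ} (t : ℕ → Fin d → V) (s : ℕ) :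
    ∃ p : Fin d → V,
      (∀ i, p i = t s i ∨ (G.Adj (t s i) (p i) ∧ movesBefore t i s < k)) ∧
      ∀ v, (Fires G k t s v →
        (∀ i ∈ mobileOn k t s v, p i ∈ unprotNbrs G t s v) ∧
        (∀ u ∈ unprotNbrs G t s v, ∃ i ∈ mobileOn k t s v, p i = u)) ∧
        (¬ Fires G k t s v → ∀ i, t s i = v → p i = t s i) := by
  classical
  have H : ∀ v, ∃ f : Fin d → V, Fires G k t s v →
      (∀ i ∈ mobileOn k t s v, f i ∈ unprotNbrs G t s v) ∧
        (∀ u ∈ unprotNbrs G t s v, ∃ i ∈ mobileOn k t s v, f i = u) := by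
    intro v
    by_cases h : Fires G k t s v
    · obtain ⟨f, hf⟩ := exists_surj _ _ h.1 h.2
      exact ⟨f, fun _ => hf⟩
    · exact ⟨t s, fun h' => absurd h' h⟩
  choose f hf using H
  refine ⟨fun i => if Fires G k t s (t s i) ∧ movesBefore t i s < k then f (t s i) i else t s i,
    ?_, ?_⟩
  · intro i
    by_cases h : Fires G k t s (t s i) ∧ movesBefore t i s < k
    · right
      simp only [h, and_self, if_true, and_true]
      exact ((hf _ h.1).1 i ⟨rfl, h.2⟩).1
    · left
      simp only [h, if_false]
  · intro v
    refine ⟨fun h => ⟨?_, ?_⟩, ?_⟩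
    · rintro i ⟨rfl, h2⟩
      simp only [h, h2, and_self, if_true]
      exact (hf _ h).1 i ⟨rfl, h2⟩
    · intro u hu
      obtain ⟨i, hi, e⟩ := (hf v h).2 u hu
      refine ⟨i, hi, ?_⟩
      obtain ⟨rfl, h2⟩ := hi
      simp only [h, h2, and_self, if_true]
      exact e
    · rintro h i rfl
      simp only [h, false_and, if_false]

/-- Histories of a play from a given layout. -/
noncomputable def hist [Finite V] (G : SimpleGraph V) (k : ℕ) {d : ℕ} (p : Fin d → V) :
    ℕ → (ℕ → Fin d → V)
  | 0 => fun _ => p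
  | s + 1 => fun j => if j ≤ s then hist G k p s j else (exists_next G k (hist G k p s) s).choose

theorem hist_eq [Finite V] (G : SimpleGraph V) (k : ℕ) {d : ℕ} (p : Fin d → V) (j s : ℕ)
    (h : j ≤ s) : hist G k p s j = hist G k p j j := by
  induction s, h using Nat.le_induction with
  | base => rfl
  | succ s h ih => rw [← ih]; simp [hist, h]

theorem exists_play [Finite V] (G : SimpleGraph V) (k : ℕ) {d : ℕ} (p : Fin d → V) :
    ∃ t : ℕ → Fin d → V, t 0 = p ∧ ValidPlay G k t := by
  let t : ℕ → Fin d → V := fun s => hist G k p s s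
  have key : ∀ s, (∀ i, t (s + 1) i = t s i ∨
      (G.Adj (t s i) (t (s + 1) i) ∧ movesBefore t i s < k)) ∧
      ∀ v, (Fires G k t s v →
        (∀ i ∈ mobileOn k t s v, t (s + 1) i ∈ unprotNbrs G t s v) ∧
        (∀ u ∈ unprotNbrs G t s v, ∃ i ∈ mobileOn k t s v, t (s + 1) i = u)) ∧
        (¬ Fires G k t s v → ∀ i, t s i = v → t (s + 1) i = t s i) := by
    intro s
    have hh : ∀ j ≤ s, hist G k p s j = t j := fun j hj => hist_eq G k p j s hj
    have e : t (s + 1) = (exists_next G k (hist G k p s) s).choose := by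
      simp [t, hist]
    have := (exists_next G k (hist G k p s) s).choose_spec
    rw [← e] at this
    simpa only [Fires, unprotNbrs_congr G hh, mobileOn_congr k hh, movesBefore_congr hh,
      hh s le_rfl] using this
  refine ⟨t, rfl, fun i s => ((key s).1 i).imp id And.left, fun i s => ?_, fun s v => (key s).2 v⟩
  induction s with
  | zero => simp [movesBefore_zero]
  | succ s ih =>
    rcases (key s).1 i with h | h
    · rw [movesBefore_succ_of_eq t i s h]; exact ih
    · have := movesBefore_succ_le t i s
      omega

theorem upper (k m n : ℕ) (hk : 2 ≤ k) (hm : 1 ≤ m) (hmn : m ≤ n) :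
    ∃ t : ℕ → Fin (m + (n + 1) / 2 - 1) → Fin m ⊕ Fin n,
      Successful (completeBipartiteGraph (Fin m) (Fin n)) k t := by
  obtain ⟨t, h0, hv⟩ := exists_play (completeBipartiteGraph (Fin m) (Fin n)) k
    (fun i : Fin (m + (n + 1) / 2 - 1) => if h : i.1 < m - 1 then
      (Sum.inl ⟨i.1, by omega⟩ : Fin m ⊕ Fin n) else Sum.inr ⟨i.1 - (m - 1), by omega⟩)
  refine ⟨t, hv, ?_⟩
  have hX : ∀ j : Fin m, j.1 < m - 1 → ∃ i, t 0 i = Sum.inl j := by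
    intro j hj
    exact ⟨⟨j.1, by omega⟩, by simp [h0, hj]⟩
  have hY : ∀ j : Fin n, j.1 < (n + 1) / 2 → ∃ i, t 0 i = Sum.inr j := by
    intro j hj
    exact ⟨⟨j.1 + (m - 1), by omega⟩, by simp [h0]⟩
  have hx0 : ∀ i, t 0 i ≠ Sum.inl ⟨m - 1, by omega⟩ := by
    intro i
    rw [h0]
    by_cases h : i.1 < m - 1
    · simp only [h, dif_pos]
      intro e
      simp at e
      omega
    · simp [h]
  have hun : ∀ j : Fin n, unprotNbrs (completeBipartiteGraph (Fin m) (Fin n)) t 0 (Sum.inr j)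
      = {Sum.inl ⟨m - 1, by omega⟩} := by
    intro j
    ext u
    simp only [unprotNbrs, protectedSet, Set.mem_ofPred_eq, Set.mem_singleton_iff]
    constructor
    · rintro ⟨h1, h2⟩
      rcases u with u | u
      · by_cases hu : u.1 < m - 1
        · obtain ⟨i, hi⟩ := hX u hu
          exact absurd ⟨i, 0, le_rfl, hi⟩ h2
        · congr 1
          ext
          simp only
          omega
      · simp at h1
    · rintro rfl
      refine ⟨by simp, ?_⟩
      rintro ⟨i, s', hs, e⟩
      obtain rfl : s' = 0 := by omega
      exact hx0 i e
  have h1 : ∀ i : Fin (m + (n + 1) / 2 - 1), m - 1 ≤ i.1 →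
      t 1 i = Sum.inl ⟨m - 1, by omega⟩ := by
    intro i hi
    obtain ⟨j, hj⟩ : ∃ j, t 0 i = Sum.inr j := by
      rw [h0]
      exact ⟨⟨i.1 - (m - 1), by omega⟩, by simp [show ¬ i.1 < m - 1 by omega]⟩
    have hmob : i ∈ mobileOn k t 0 (Sum.inr j) := ⟨hj, by rw [movesBefore_zero]; omega⟩
    have := ((hv.2.2 0 (Sum.inr j)).1 ⟨by rw [hun]; simp, by
      rw [hun, Set.ncard_singleton]
      exact Nat.succ_le_of_lt ((Set.ncard_pos (Set.toFinite _)).2 ⟨i, hmob⟩)⟩).1 i hmob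
    rw [hun] at this
    exact this
  have hmob1 : {i : Fin (m + (n + 1) / 2 - 1) | m - 1 ≤ i.1} ⊆
      mobileOn k t 1 (Sum.inl ⟨m - 1, by omega⟩) := by
    intro i hi
    refine ⟨h1 i hi, ?_⟩
    have := movesBefore_succ_le t i 0
    rw [movesBefore_zero] at this
    simp only [zero_add] at this
    omega
  have hc1 : (n + 1) / 2 ≤ (mobileOn k t 1 (Sum.inl ⟨m - 1, by omega⟩)).ncard := by
    refine le_trans ?_ (Set.ncard_le_ncard hmob1 (Set.toFinite _))
    have : Set.range (fun j : Fin ((n + 1) / 2) =>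
        (⟨j.1 + (m - 1), by omega⟩ : Fin (m + (n + 1) / 2 - 1))) ⊆
        {i : Fin (m + (n + 1) / 2 - 1) | m - 1 ≤ i.1} := by
      rintro _ ⟨j, rfl⟩
      exact Nat.le_add_left _ _
    refine le_trans ?_ (Set.ncard_le_ncard this (Set.toFinite _))
    rw [← Set.image_univ, Set.ncard_image_of_injective]
    · simp [Set.ncard_univ]
    · intro a b hab
      simp only [Fin.mk.injEq] at hab
      ext
      omega
  have hc2 : (unprotNbrs (completeBipartiteGraph (Fin m) (Fin n)) t 1
      (Sum.inl ⟨m - 1, by omega⟩)).ncard ≤ n - (n + 1) / 2 := by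
    have : unprotNbrs (completeBipartiteGraph (Fin m) (Fin n)) t 1 (Sum.inl ⟨m - 1, by omega⟩) ⊆
        Set.range (fun j : Fin (n - (n + 1) / 2) =>
          (Sum.inr ⟨j.1 + (n + 1) / 2, by omega⟩ : Fin m ⊕ Fin n)) := by
      rintro (u | u) ⟨hu, hu2⟩
      · simp at hu
      · by_cases h : u.1 < (n + 1) / 2
        · obtain ⟨i, hi⟩ := hY u h
          exact absurd ⟨i, 0, by omega, hi⟩ hu2
        · refine ⟨⟨u.1 - (n + 1) / 2, by omega⟩, ?_⟩
          simp only [Sum.inr.injEq]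
          ext
          simp only
          omega
    refine le_trans (Set.ncard_le_ncard this (Set.toFinite _)) ?_
    rw [← Set.image_univ]
    refine le_trans (Set.ncard_image_le (Set.toFinite _)) ?_
    simp [Set.ncard_univ]
  rintro (j | j)
  · by_cases hj : j.1 < m - 1
    · obtain ⟨i, hi⟩ := hX j hj
      exact ⟨i, 0, hi⟩
    · refine ⟨⟨m - 1, by omega⟩, 1, ?_⟩
      rw [h1 _ le_rfl]
      congr 1
      ext
      simp only
      omega
  · by_cases hj : (Sum.inr j : Fin m ⊕ Fin n) ∈ protectedSet t 1
    · obtain ⟨i, s, _, e⟩ := hj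
      exact ⟨i, s, e⟩
    · have hmem : (Sum.inr j : Fin m ⊕ Fin n) ∈ unprotNbrs
          (completeBipartiteGraph (Fin m) (Fin n)) t 1 (Sum.inl ⟨m - 1, by omega⟩) :=
        ⟨by simp, hj⟩
      obtain ⟨i, _, hi⟩ := ((hv.2.2 1 _).1 ⟨⟨_, hmem⟩, by omega⟩).2 _ hmem
      exact ⟨i, 2, hi⟩

theorem static {G : SimpleGraph V} {k d : ℕ} {t : ℕ → Fin d → V} (hv : ValidPlay G k t) (s : ℕ)
    (h : ∀ v, ¬ Fires G k t s v) (r : ℕ) : t (s + r) = t s ∧ ∀ v, ¬ Fires G k t (s + r) v := by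
  induction r with
  | zero => exact ⟨rfl, h⟩
  | succ r ih =>
    have e : t (s + r + 1) = t (s + r) := by
      funext i
      exact (hv.2.2 (s + r) _).2 (ih.2 _) i rfl
    have hp : protectedSet t (s + r + 1) = protectedSet t (s + r) := by
      ext v
      constructor
      · rintro ⟨i, s', hs, hh⟩
        rcases Nat.lt_succ_iff_lt_or_eq.1 (Nat.lt_succ_of_le hs) with h' | h'
        · exact ⟨i, s', by omega, hh⟩
        · subst h'
          exact ⟨i, s + r, le_rfl, by rw [← e]; exact hh⟩
      · rintro ⟨i, s', hs, hh⟩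
        exact ⟨i, s', by omega, hh⟩
    refine ⟨e.trans ih.1, fun v hf => ih.2 v ?_⟩
    change Fires G k t (s + r + 1) v at hf
    unfold Fires unprotNbrs mobileOn at hf ⊢
    rw [hp, e] at hf
    simpa only [movesBefore_succ_of_eq t _ (s + r) (congrFun e _)] using hf

theorem exists_fires {G : SimpleGraph V} {k d : ℕ} {t : ℕ → Fin d → V} (hs : Successful G k t)
    (s : ℕ) {u : V} (hu : u ∉ protectedSet t s) : ∃ v, Fires G k t s v := by
  by_contra! hcon
  obtain ⟨i, r, hi⟩ := hs.2 u
  by_cases h : r ≤ s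
  · exact hu ⟨i, r, h, hi⟩
  · obtain ⟨q, rfl⟩ := Nat.exists_eq_add_of_le (not_le.1 h).le
    rw [(static hs.1 s hcon q).1] at hi
    exact hu ⟨i, s, le_rfl, hi⟩

section Lower
open Classical

variable [Fintype V]

/-- Number of searchers initially at `v`. -/
noncomputable def cnt {d : ℕ} (t : ℕ → Fin d → V) (v : V) : ℕ :=
  (Finset.univ.filter fun i => t 0 i = v).card

/-- Initially unoccupied vertices of `S`. -/
noncomputable def unocc {d : ℕ} (t : ℕ → Fin d → V) (S : Finset V) : Finset V :=
  S.filter fun v => v ∉ protectedSet t 0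

theorem mem_prot_zero {d : ℕ} (t : ℕ → Fin d → V) (v : V) :
    v ∈ protectedSet t 0 ↔ ∃ i, t 0 i = v := by
  constructor
  · rintro ⟨i, s, hs, e⟩
    obtain rfl : s = 0 := by omega
    exact ⟨i, e⟩
  · rintro ⟨i, e⟩; exact ⟨i, 0, le_rfl, e⟩

theorem cnt_pos {d : ℕ} (t : ℕ → Fin d → V) (v : V) : v ∈ protectedSet t 0 ↔ 0 < cnt t v := by
  rw [mem_prot_zero, cnt, Finset.card_pos]
  simp [Finset.Nonempty]

theorem sum_cnt {d : ℕ} (t : ℕ → Fin d → V) (S : Finset V) :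
    ∑ v ∈ S, cnt t v = (Finset.univ.filter fun i => t 0 i ∈ S).card := by
  rw [Finset.card_eq_sum_card_fiberwise (f := t 0) (t := S)]
  · refine Finset.sum_congr rfl fun v hv => ?_
    unfold cnt
    congr 1
    ext i
    simp only [Finset.mem_filter, Finset.mem_univ, true_and]
    constructor
    · intro h; exact ⟨h ▸ hv, h⟩
    · exact And.right
  · intro i hi
    simpa using hi

theorem sum_ge {d : ℕ} (t : ℕ → Fin d → V) (S : Finset V) :
    S.card ≤ ∑ v ∈ S, cnt t v + (unocc t S).card := by
  rw [← Finset.card_filter_add_card_filter_not (s := S) (fun v => v ∈ protectedSet t 0)]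
  have : (S.filter fun v => v ∈ protectedSet t 0).card ≤ ∑ v ∈ S, cnt t v := by
    rw [Finset.card_filter]
    refine Finset.sum_le_sum fun v _ => ?_
    split_ifs with h
    · exact (cnt_pos t v).1 h
    · exact Nat.zero_le _
  unfold unocc
  omega

theorem sum_ge' {d : ℕ} (t : ℕ → Fin d → V) (S : Finset V) (v : V) (hv : v ∈ S) :
    S.card + cnt t v ≤ ∑ v ∈ S, cnt t v + (unocc t S).card + 1 := by
  have h := sum_ge t (S.erase v)
  have h1 : (unocc t (S.erase v)).card ≤ (unocc t S).card :=
    Finset.card_le_card (Finset.filter_subset_filter _ (Finset.erase_subset _ _))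
  have h2 := Finset.add_sum_erase S (cnt t) hv
  have h3 := Finset.card_erase_add_one hv
  omega

/-- `G` is the complete bipartite graph with parts `A`, `B`. -/
structure Parts (G : SimpleGraph V) (A B : Finset V) : Prop where
  cover : ∀ v, v ∈ A ∨ v ∈ B
  disj : ∀ v, v ∈ A → v ∉ B
  adj : ∀ u v, G.Adj u v ↔ (u ∈ A ∧ v ∈ B) ∨ (u ∈ B ∧ v ∈ A)

theorem Parts.symm {G : SimpleGraph V} {A B : Finset V} (h : Parts G A B) : Parts G B A :=
  ⟨fun v => (h.cover v).symm, fun v hb ha => h.disj v ha hb, fun u v => (h.adj u v).trans or_comm⟩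

theorem Parts.sum {G : SimpleGraph V} {A B : Finset V} (h : Parts G A B) {d : ℕ}
    (t : ℕ → Fin d → V) : ∑ v ∈ A, cnt t v + ∑ v ∈ B, cnt t v = d := by
  rw [← Finset.sum_union (Finset.disjoint_left.2 fun v => h.disj v), sum_cnt]
  rw [Finset.filter_true_of_mem]
  · simp
  · intro i _
    exact Finset.mem_union.2 (h.cover _)

theorem Parts.unprot {G : SimpleGraph V} {A B : Finset V} (h : Parts G A B) {d : ℕ}
    (t : ℕ → Fin d → V) {v : V} (hv : v ∈ B) : unprotNbrs G t 0 v = ↑(unocc t A) := by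
  ext u
  have := h.disj v
  simp only [unprotNbrs, unocc, Set.mem_ofPred_eq, Finset.coe_filter, h.adj]
  tauto

theorem mobile_zero {k d : ℕ} (hk : 2 ≤ k) (t : ℕ → Fin d → V) (v : V) :
    mobileOn k t 0 v = {i | t 0 i = v} := by
  ext i
  simp only [mobileOn, movesBefore_zero, Set.mem_ofPred_eq]
  constructor
  · exact And.left
  · intro h; exact ⟨h, by omega⟩

theorem Parts.fires {G : SimpleGraph V} {A B : Finset V} (h : Parts G A B) {k d : ℕ}
    (hk : 2 ≤ k) (t : ℕ → Fin d → V) {v : V} (hv : v ∈ B) :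
    Fires G k t 0 v ↔ 0 < (unocc t A).card ∧ (unocc t A).card ≤ cnt t v := by
  unfold Fires
  rw [h.unprot t hv, mobile_zero hk, Set.ncard_coe_finset, Finset.coe_nonempty, Finset.card_pos,
    cnt, ← Set.ncard_coe_finset (Finset.univ.filter _)]
  simp

theorem Parts.main {G : SimpleGraph V} {A B : Finset V} (h : Parts G A B) {k d : ℕ}
    (hk : 2 ≤ k) (t : ℕ → Fin d → V) (hs : Successful G k t) {b : V} (hb : b ∈ B)
    (hf : Fires G k t 0 b) (hA : ∀ a ∈ A, ¬ Fires G k t 0 a) (hq : (unocc t B).Nonempty) :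
    2 * A.card + B.card ≤ 2 * d + 2 := by
  have hf' := (h.fires hk t hb).1 hf
  have s1 := sum_ge t A
  have s2 := sum_ge' t B b hb
  have s3 := h.sum t
  have hv := hs.1
  have stay : ∀ i, t 0 i ∈ A → t 1 i = t 0 i := fun i hi => (hv.2.2 0 _).2 (hA _ hi) i rfl
  have move : ∀ i, t 1 i = t 0 i ∨ (t 0 i ∈ B ∧ t 1 i ∈ unocc t A) := by
    intro i
    rcases h.cover (t 0 i) with hi | hi
    · exact Or.inl (stay i hi)
    · by_cases hfi : Fires G k t 0 (t 0 i)
      · right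
        refine ⟨hi, ?_⟩
        have := ((hv.2.2 0 _).1 hfi).1 i (by rw [mobile_zero hk]; rfl)
        rw [h.unprot t hi] at this
        exact this
      · exact Or.inl ((hv.2.2 0 _).2 hfi i rfl)
  have covA : ∀ u ∈ unocc t A, ∃ i, t 0 i = b ∧ t 1 i = u := by
    intro u hu
    obtain ⟨i, hi, e⟩ := ((hv.2.2 0 _).1 hf).2 u (by rw [h.unprot t hb]; exact hu)
    exact ⟨i, hi.1, e⟩
  have protA : ∀ u ∈ A, u ∈ protectedSet t 1 := by
    intro u hu
    by_cases h0 : u ∈ protectedSet t 0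
    · obtain ⟨i, e⟩ := (mem_prot_zero t u).1 h0
      exact ⟨i, 0, by omega, e⟩
    · obtain ⟨i, _, e⟩ := covA u (Finset.mem_filter.2 ⟨hu, h0⟩)
      exact ⟨i, 1, le_rfl, e⟩
  have protB : ∀ u ∈ unocc t B, u ∉ protectedSet t 1 := by
    rintro u hu ⟨i, s, hs, e⟩
    obtain ⟨huB, hu0⟩ := Finset.mem_filter.1 hu
    rw [mem_prot_zero] at hu0
    obtain rfl | rfl : s = 0 ∨ s = 1 := by omega
    · exact hu0 ⟨i, e⟩
    · rcases move i with h' | h'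
      · exact hu0 ⟨i, by rw [← h']; exact e⟩
      · rw [e] at h'
        exact h.disj u (Finset.mem_filter.1 h'.2).1 huB
  obtain ⟨u, hu⟩ := hq
  obtain ⟨x, hx⟩ := exists_fires hs 1 (protB u hu)
  have hxA : x ∈ A := by
    rcases h.cover x with h' | h'
    · exact h'
    · exfalso
      obtain ⟨w, hw, hw2⟩ := hx.1
      rcases (h.adj x w).1 hw with h3 | h3
      · exact h.disj x h3.1 h'
      · exact hw2 (protA w h3.2)
  have hq1 : (unocc t B).card ≤ (mobileOn k t 1 x).ncard := by
    refine le_trans ?_ hx.2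
    rw [← Set.ncard_coe_finset]
    refine Set.ncard_le_ncard ?_ (Set.toFinite _)
    intro w hw
    exact ⟨(h.adj x w).2 (Or.inl ⟨hxA, (Finset.mem_filter.1 hw).1⟩), protB w hw⟩
  have hxU : x ∈ unocc t A := by
    by_contra hcon
    refine hA x hxA ((h.symm.fires hk t hxA).2 ⟨Finset.card_pos.2 ⟨u, hu⟩, hq1.trans ?_⟩)
    rw [cnt, ← Set.ncard_coe_finset]
    refine Set.ncard_le_ncard ?_ (Set.toFinite _)
    rintro i ⟨hi, _⟩
    simp only [Finset.coe_filter, Finset.mem_univ, true_and, Set.mem_ofPred_eq]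
    rcases move i with h' | h'
    · rw [← h']; exact hi
    · rw [hi] at h'; exact absurd h'.2 hcon
  have s4 : (unocc t B).card + (unocc t A).card ≤ ∑ v ∈ B, cnt t v + 1 := by
    rw [sum_cnt]
    rw [← Finset.card_filter_add_card_filter_not
      (s := Finset.univ.filter fun i => t 0 i ∈ B) (fun i => t 1 i = x)]
    have e1 : (unocc t B).card ≤
        ((Finset.univ.filter fun i => t 0 i ∈ B).filter fun i => t 1 i = x).card := by
      refine hq1.trans ?_
      rw [← Set.ncard_coe_finset]
      refine Set.ncard_le_ncard ?_ (Set.toFinite _)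
      rintro i ⟨hi, _⟩
      simp only [Finset.coe_filter, Finset.mem_filter, Finset.mem_univ, true_and, Set.mem_ofPred_eq]
      refine ⟨?_, hi⟩
      rcases move i with h' | h'
      · have := (Finset.mem_filter.1 hxU).2
        rw [mem_prot_zero] at this
        exact absurd ⟨i, by rw [← h']; exact hi⟩ this
      · exact h'.1
    have e2 : ((unocc t A).erase x).card ≤
        ((Finset.univ.filter fun i => t 0 i ∈ B).filter fun i => ¬ t 1 i = x).card := by
      refine le_trans (Finset.card_le_card ?_) (Finset.card_image_le (f := t 1))
      intro w hw
      obtain ⟨hwx, hw⟩ := Finset.mem_erase.1 hw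
      obtain ⟨i, hi, e⟩ := covA w hw
      simp only [Finset.mem_image, Finset.mem_filter, Finset.mem_univ, true_and]
      exact ⟨i, ⟨by rw [hi]; exact hb, by rw [e]; exact hwx⟩, e⟩
    have := Finset.card_erase_add_one hxU
    omega
  omega

theorem Parts.lower {G : SimpleGraph V} {A B : Finset V} (h : Parts G A B) {k d : ℕ}
    (hk : 2 ≤ k) (t : ℕ → Fin d → V) (hs : Successful G k t) (hA1 : 1 ≤ A.card)
    (hAB : A.card ≤ B.card) : 2 * A.card + B.card ≤ 2 * d + 2 := by
  have a1 := sum_ge t A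
  have b1 := sum_ge t B
  have a2 := sum_ge' t A
  have b2 := sum_ge' t B
  have hsum := h.sum t
  have fB : ∀ b ∈ B, _ := fun b hb => h.fires (k := k) hk t hb
  have fA : ∀ a ∈ A, _ := fun a ha => h.symm.fires (k := k) hk t ha
  by_cases hFA : ∃ a ∈ A, Fires G k t 0 a
  · obtain ⟨a, ha, hfa⟩ := hFA
    have a3 := (fA a ha).1 hfa
    have a4 := a2 a ha
    by_cases hFB : ∃ b ∈ B, Fires G k t 0 b
    · obtain ⟨b, hb, hfb⟩ := hFB
      have b3 := (fB b hb).1 hfb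
      have b4 := b2 b hb
      have : unocc t B ⊂ B := by
        refine Finset.ssubset_iff_subset_ne.2 ⟨Finset.filter_subset _ _, fun e => ?_⟩
        rw [← e] at hb
        exact (Finset.mem_filter.1 hb).2 ((cnt_pos t b).2 (by omega))
      have := Finset.card_lt_card this
      omega
    · push Not at hFB
      by_cases hp : (unocc t A).Nonempty
      · have := h.symm.main hk t hs ha hfa hFB hp
        omega
      · rw [Finset.not_nonempty_iff_eq_empty] at hp
        rw [hp, Finset.card_empty] at a4
        omega
  · push Not at hFA
    by_cases hFB : ∃ b ∈ B, Fires G k t 0 b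
    · obtain ⟨b, hb, hfb⟩ := hFB
      have b3 := (fB b hb).1 hfb
      have b4 := b2 b hb
      by_cases hp : (unocc t B).Nonempty
      · exact h.main hk t hs hb hfb hFA hp
      · rw [Finset.not_nonempty_iff_eq_empty] at hp
        rw [hp, Finset.card_empty] at b4
        omega
    · push Not at hFB
      have hall : ∀ u, u ∈ protectedSet t 0 := by
        intro u
        by_contra hu
        obtain ⟨v, hv⟩ := exists_fires hs 0 hu
        rcases h.cover v with h' | h'
        · exact hFA v h' hv
        · exact hFB v h' hv
      have eA : unocc t A = ∅ := Finset.filter_eq_empty_iff.2 fun v _ => by simp [hall v]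
      have eB : unocc t B = ∅ := Finset.filter_eq_empty_iff.2 fun v _ => by simp [hall v]
      rw [eA, Finset.card_empty] at a1
      rw [eB, Finset.card_empty] at b1
      omega

end Lower

theorem lower (k m n : ℕ) (hk : 2 ≤ k) (hm : 1 ≤ m) (hmn : m ≤ n) {d : ℕ}
    (t : ℕ → Fin d → Fin m ⊕ Fin n)
    (hs : Successful (completeBipartiteGraph (Fin m) (Fin n)) k t) :
    2 * m + n ≤ 2 * d + 2 := by
  have h : Parts (completeBipartiteGraph (Fin m) (Fin n))
      (Finset.univ.map Function.Embedding.inl) (Finset.univ.map Function.Embedding.inr) := by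
    refine ⟨?_, ?_, ?_⟩
    · rintro (v | v) <;> simp
    · rintro (v | v) <;> simp
    · rintro (v | v) (u | u) <;> simp
  have := h.lower hk t hs (by simpa using hm) (by simpa using hmn)
  simpa using this

end Deduction

/-- `d_k(K_{m,n}) = m + ⌈n / 2⌉ - 1` for `k ≥ 2`, `n ≥ m ≥ 1`. -/
theorem stmt_13 (k m n : ℕ) (hk : 2 ≤ k) (hm : 1 ≤ m) (hmn : m ≤ n) :
    Deduction.deductionNumber (completeBipartiteGraph (Fin m) (Fin n)) k =
      m + ⌈(n : ℚ) / 2⌉₊ - 1 := by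
  have hc : ⌈(n : ℚ) / 2⌉₊ = (n + 1) / 2 := by
    have h := Nat.div_add_mod (n + 1) 2
    have h2 := Nat.mod_lt (n + 1) (show 0 < 2 by norm_num)
    set q := (n + 1) / 2
    have h3 : n ≤ 2 * q := by omega
    have h4 : 2 * q ≤ n + 1 := by omega
    have h3' : (n : ℚ) ≤ 2 * q := by exact_mod_cast h3
    have h4' : 2 * (q : ℚ) ≤ n + 1 := by exact_mod_cast h4
    apply le_antisymm
    · rw [Nat.ceil_le]; linarith
    · have := Nat.le_ceil ((n : ℚ) / 2)
      have h5 : (2 * q : ℚ) ≤ 2 * (⌈(n : ℚ) / 2⌉₊ : ℚ) + 1 := by linarith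
      have h6 : 2 * q ≤ 2 * ⌈(n : ℚ) / 2⌉₊ + 1 := by exact_mod_cast h5
      omega
  rw [hc]
  have hU := Deduction.upper k m n hk hm hmn
  apply le_antisymm
  · exact Nat.sInf_le hU
  · obtain ⟨t, ht⟩ := Nat.sInf_mem (s := {d : ℕ | ∃ t : ℕ → Fin d → Fin m ⊕ Fin n,
      Deduction.Successful (completeBipartiteGraph (Fin m) (Fin n)) k t}) ⟨_, hU⟩
    have := Deduction.lower k m n hk hm hmn t ht
    unfold Deduction.deductionNumber
    omega
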